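/- arXiv:2301.12628 — 2 statements merged into one kernel-verified Lean document; each statement's English description precedes it below -/
import Mathlib

section
/- Let u, v > 0 be real numbers and set R₁ = u²·v² − 4·u²·v − 4·u·v² + 18·u·v − 27, S₃ = u³·v³ − 4·u³·v² − 4·u²·v³ + 15·u²·v² + 12·u²·v + 12·u·v² − 85·u·v + 125, A₁ = u·v − 15, and A₂ = u²·v² − 4·u²·v − 5·u·v² + 21·u·v + 11·v − 60. If R₁ > 0, S₃ > 0, A₁ < 0 and A₂ > 0, then the set { (x, y) ∈ ℝ² : x > 0, y > 0, x = u·y·(1−y), y = v·x·(1−x), and |u·v·(1−2x)·(1−2y)| < 1 } of stable positive equilibria of Kopel's model with best response reactions (a = b = 1) has exactly two elements. -/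
/-- Numerical bound. -/
lemma kopel_B (r : ℝ) (hlo : 3.449 < r) (hhi : r < 3.4642) : 0.8 < r * (r - 3) * (4 - r) := by
  have h1 : 3.449 * 0.449 ≤ r * (r - 3) :=
    mul_le_mul (by linarith) (by linarith) (by norm_num) (by linarith)
  have h2 : 3.449 * 0.449 * 0.5358 ≤ r * (r - 3) * (4 - r) :=
    mul_le_mul h1 (by linarith) (by norm_num) (by nlinarith)
  norm_num at h2 ⊢
  linarith

/-- Numerical bound. -/
lemma kopel_Ap (r : ℝ) (hlo : 3.449 < r) (hhi : r < 3.4642) :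
    0 < -r ^ 4 + 10 * r ^ 3 - 21 * r ^ 2 - 22 * r + 60 ∧
    -r ^ 4 + 10 * r ^ 3 - 21 * r ^ 2 - 22 * r + 60 < 4 := by
  obtain ⟨t, ht⟩ : ∃ t, t = r - 3.449 := ⟨_, rfl⟩
  have ht0 : 0 < t := by linarith
  have ht1 : t < 0.0152 := by linarith
  have hrt : r = t + 3.449 := by linarith
  subst hrt
  clear hlo hhi ht
  have ht2 : 0 < t ^ 2 := by positivity
  have ht3 : 0 < t ^ 3 := by positivity
  have ht4 : 0 < t ^ 4 := by positivity
  have ht2u : t ^ 2 < 0.001 := by nlinarith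
  have ht3u : t ^ 3 < 0.001 := by
    have : t ^ 3 = t ^ 2 * t := by ring
    nlinarith
  have ht4u : t ^ 4 < 0.001 := by
    have : t ^ 4 = t ^ 3 * t := by ring
    nlinarith
  constructor <;> linarith

set_option maxHeartbeats 2000000 in
/-- The remaining narrow range `r² < 12`. -/
lemma kopel_core (r v : ℝ) (hlo : 3.449 < r) (hhi : r < 3.4642)
    (he : 0 < r ^ 2 - 2 * r - 5)
    (hA : (5 * r ^ 2 - 11) * v ^ 2 - (r ^ 4 + 21 * r ^ 2 - 60) * v + 4 * r ^ 4 < 0)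
    (hS : 4 * r ^ 2 * (r ^ 2 - 3) * (v - r) ^ 2
      < v * ((r ^ 2 - 2 * r - 5) ^ 2 * (r ^ 2 - 4 * r + 5))) : False := by
  obtain ⟨d, hd⟩ : ∃ d, d = v - r := ⟨_, rfl⟩
  obtain ⟨e, hee⟩ : ∃ e, e = r ^ 2 - 2 * r - 5 := ⟨_, rfl⟩
  obtain ⟨Ap, hApDef⟩ : ∃ Ap, Ap = -r ^ 4 + 10 * r ^ 3 - 21 * r ^ 2 - 22 * r + 60 := ⟨_, rfl⟩
  obtain ⟨B, hB⟩ : ∃ B, B = r * (r - 3) * (4 - r) := ⟨_, rfl⟩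
  have hAd : B * e + Ap * d + (5 * r ^ 2 - 11) * d ^ 2 < 0 := by
    subst hd hee hApDef hB; linarith
  rw [← hd, ← hee] at hS
  rw [← hee] at he
  have hBl : 0.8 < B := hB ▸ kopel_B r hlo hhi
  have hApBd : 0 < Ap ∧ Ap < 4 := hApDef ▸ kopel_Ap r hlo hhi
  have hr1 : 11.8 < r ^ 2 := by nlinarith
  have hr2 : r ^ 2 - 4 * r + 5 ≤ 4 := by nlinarith
  have hr3 : 0 ≤ r ^ 2 - 4 * r + 5 := by nlinarith [sq_nonneg (r - 2)]
  clear hA hApDef hB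
  have hdn : d < -0.2 * e := by
    by_contra hcon
    push Not at hcon
    have h1 : 0 ≤ (5 * r ^ 2 - 11) * d ^ 2 := mul_nonneg (by nlinarith) (sq_nonneg _)
    nlinarith [mul_nonneg hApBd.1.le (by linarith : 0 ≤ d + 0.2 * e),
      mul_pos he (by linarith : 0 < B - 0.8), mul_pos he (by linarith : 0 < 4 - Ap)]
  have hd2 : 0.04 * e ^ 2 < d ^ 2 := by nlinarith
  have hvr : v < 3.4642 := by linarith
  have h1 : 400 ≤ 4 * r ^ 2 * (r ^ 2 - 3) := by
    have : 11.8 < r ^ 2 := by nlinarith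
    nlinarith
  have h2 : v * (r ^ 2 - 4 * r + 5) ≤ 3.4642 * 4 := by
    apply mul_le_mul hvr.le _ (by nlinarith [sq_nonneg (r - 2)]) (by norm_num)
    nlinarith
  have h3 := mul_le_mul_of_nonneg_right h1 (sq_nonneg d)
  have h4 := mul_le_mul_of_nonneg_right h2 (sq_nonneg e)
  nlinarith [sq_nonneg e]

set_option maxHeartbeats 2000000 in
/-- The polynomial inequality needed to exclude two unstable outer equilibria. -/
lemma kopel_c2_nonneg
    (u v : ℝ) (hu : 0 < u) (hv : 0 < v)
    (hR1 : 0 < u ^ 2 * v ^ 2 - 4 * u ^ 2 * v - 4 * u * v ^ 2 + 18 * u * v - 27)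
    (hS3 : 0 < u ^ 3 * v ^ 3 - 4 * u ^ 3 * v ^ 2 - 4 * u ^ 2 * v ^ 3 + 15 * u ^ 2 * v ^ 2 +
      12 * u ^ 2 * v + 12 * u * v ^ 2 - 85 * u * v + 125)
    (hA1 : u * v - 15 < 0)
    (hA2 : 0 < u ^ 2 * v ^ 2 - 4 * u ^ 2 * v - 5 * u * v ^ 2 + 21 * u * v + 11 * v - 60) :
    0 ≤ 75 - 22 * (u * v) - (u * v) ^ 2 + 4 * (u * v) * (u + v) := by
  by_contra hneg
  push Not at hneg
  have hw : 0 < u * v := mul_pos hu hv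
  obtain ⟨r, hr, hrw⟩ : ∃ r : ℝ, 0 < r ∧ u * v = r ^ 2 :=
    ⟨√(u * v), Real.sqrt_pos.mpr hw, (Real.sq_sqrt hw.le).symm⟩
  have hsum : 2 * r ≤ u + v := by
    refine (sq_le_sq₀ (by positivity) (by positivity)).mp ?_
    nlinarith [sq_nonneg (u - v)]
  have hR : 0 < (r - 3) ^ 3 * (r + 1) := by
    have h1 : 0 < (u * v) ^ 2 - 4 * (u * v) * (u + v) + 18 * (u * v) - 27 := by linarith
    rw [hrw] at h1
    nlinarith [mul_le_mul_of_nonneg_left hsum (by positivity : 0 ≤ 4 * r ^ 2)]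
  have hr3 : 3 < r := by
    have h1 : 0 < (r - 3) ^ 3 := pos_of_mul_pos_left hR (by linarith)
    by_contra h
    have : (r - 3) ^ 3 ≤ 0 := by
      have : 0 ≤ (3 - r) ^ 3 := pow_nonneg (by linarith) 3
      nlinarith
    linarith
  have he : 0 < r ^ 2 - 2 * r - 5 := by
    rw [hrw] at hneg
    have h1 : 0 < (r ^ 2 - 2 * r - 5) * (r ^ 2 - 6 * r + 15) := by
      nlinarith [mul_le_mul_of_nonneg_left hsum (by positivity : 0 ≤ 4 * r ^ 2)]
    exact pos_of_mul_pos_left h1 (by nlinarith [sq_nonneg (r - 3)])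
  have hA : (5 * r ^ 2 - 11) * v ^ 2 - (r ^ 4 + 21 * r ^ 2 - 60) * v + 4 * r ^ 4 < 0 := by
    have h1 := mul_pos hv hA2
    have h2 : v * (u ^ 2 * v ^ 2 - 4 * u ^ 2 * v - 5 * u * v ^ 2 + 21 * u * v + 11 * v - 60)
      = -((5 * (u * v) - 11) * v ^ 2 - ((u * v) ^ 2 + 21 * (u * v) - 60) * v
        + 4 * (u * v) ^ 2) := by ring
    rw [h2, hrw] at h1
    nlinarith
  have hS : 4 * r ^ 2 * (r ^ 2 - 3) * (v - r) ^ 2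
      < v * ((r ^ 2 - 2 * r - 5) ^ 2 * (r ^ 2 - 4 * r + 5)) := by
    have h1 := mul_pos hv hS3
    have h2 : v * (u ^ 3 * v ^ 3 - 4 * u ^ 3 * v ^ 2 - 4 * u ^ 2 * v ^ 3 + 15 * u ^ 2 * v ^ 2 +
      12 * u ^ 2 * v + 12 * u * v ^ 2 - 85 * u * v + 125)
      = v * (u * v) ^ 3 - 4 * (u * v) ^ 3 - 4 * (u * v) ^ 2 * v ^ 2 + 15 * (u * v) ^ 2 * v
        + 12 * (u * v) ^ 2 + 12 * (u * v) * v ^ 2 - 85 * (u * v) * v + 125 * v := by ring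
    rw [h2, hrw] at h1
    nlinarith
  rw [hrw] at hA1
  rcases le_or_gt 12 (r ^ 2) with h12 | h12
  · have hd : 0 ≤ (r ^ 2 - 12) * (15 - r ^ 2) * ((r ^ 2) ^ 2 - 11 * r ^ 2 + 20) := by
      apply mul_nonneg (mul_nonneg (by linarith) (by linarith))
      have := mul_nonneg (by linarith : 0 ≤ r ^ 2 - 12) (by linarith : 0 ≤ r ^ 2)
      linarith
    have h5 : 0 < 5 * r ^ 2 - 11 := by linarith
    have h6 := mul_neg_of_pos_of_neg h5 hA
    have h7 := sq_nonneg (2 * (5 * r ^ 2 - 11) * v - (r ^ 4 + 21 * r ^ 2 - 60))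
    linarith
  · have hlo : 3.449 < r := by nlinarith
    have hhi : r < 3.4642 := by nlinarith
    exact kopel_core r v hlo hhi he hA hS

/-- Three ordered roots of the cubic `x³ - 2x² + p x - q`, from positive discriminant. -/
lemma kopel_three_roots (p q : ℝ)
    (hdisc : 0 < 4 * p ^ 2 - 4 * p ^ 3 - 32 * q + 36 * p * q - 27 * q ^ 2)
    (a : ℝ) (ha : a ^ 3 - 2 * a ^ 2 + p * a - q = 0) :
    ∃ x y z : ℝ, x < y ∧ y < z ∧ x + y + z = 2 ∧ x * y + y * z + z * x = p ∧ x * y * z = q := by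
  have hq : q = a ^ 3 - 2 * a ^ 2 + p * a := by linarith
  subst hq
  have hfac : 0 < ((a - 2) ^ 2 - 4 * (p + a ^ 2 - 2 * a)) * (3 * a ^ 2 - 4 * a + p) ^ 2 := by
    nlinarith
  have hD : 0 < (a - 2) ^ 2 - 4 * (p + a ^ 2 - 2 * a) :=
    pos_of_mul_pos_left hfac (sq_nonneg _)
  have hne : 3 * a ^ 2 - 4 * a + p ≠ 0 := by
    intro h; rw [h] at hfac; simp at hfac
  obtain ⟨t, ht0, ht⟩ : ∃ t : ℝ, 0 < t ∧ t ^ 2 = (a - 2) ^ 2 - 4 * (p + a ^ 2 - 2 * a) :=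
    ⟨√_, Real.sqrt_pos.mpr hD, Real.sq_sqrt hD.le⟩
  obtain ⟨b, hb⟩ : ∃ b, b = (2 - a - t) / 2 := ⟨_, rfl⟩
  obtain ⟨c, hc⟩ : ∃ c, c = (2 - a + t) / 2 := ⟨_, rfl⟩
  have hbc : b < c := by linarith
  have h1 : a + b + c = 2 := by linarith
  have h2 : a * b + b * c + c * a = p := by
    subst hb hc; linear_combination (-1 / 4) * ht
  have h3 : a * b * c = a ^ 3 - 2 * a ^ 2 + p * a := by
    linear_combination a * h2 - a ^ 2 * h1
  have hab : a ≠ b := by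
    intro h; apply hne; rw [← h2]; subst h
    linear_combination (2 * a) * h1
  have hac : a ≠ c := by
    intro h; apply hne; rw [← h2]; subst h
    linear_combination (2 * a) * h1
  rcases lt_or_gt_of_ne hab with h | h
  · exact ⟨a, b, c, h, hbc, h1, h2, h3⟩
  · rcases lt_or_gt_of_ne hac with hh | hh
    · exact ⟨b, a, c, h, hh, by linarith, by linarith, by linarith⟩
    · exact ⟨b, c, a, hbc, hh, by linarith, by linarith, by linarith⟩

/-- If the sum and second symmetric function are nonnegative, two roots cannot be negative. -/
lemma kopel_no_two_neg (x y z : ℝ) (hx : x < 0) (hz : z < 0) (hsum : 0 < x + y + z)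
    (h2 : 0 ≤ x * y + y * z + z * x) : False := by
  nlinarith [mul_pos hsum (by linarith : 0 < -(x + z)), mul_pos_of_neg_of_neg hx hz,
    sq_nonneg x, sq_nonneg z]

set_option maxHeartbeats 2000000 in

/-- Two stable positive equilibria for Kopel's model with best response reactions. -/
theorem kopel_two_stable_positive_equilibria
    (u v : ℝ) (hu : 0 < u) (hv : 0 < v)
    (hR1 : 0 < u ^ 2 * v ^ 2 - 4 * u ^ 2 * v - 4 * u * v ^ 2 + 18 * u * v - 27)
    (hS3 : 0 < u ^ 3 * v ^ 3 - 4 * u ^ 3 * v ^ 2 - 4 * u ^ 2 * v ^ 3 + 15 * u ^ 2 * v ^ 2 +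
      12 * u ^ 2 * v + 12 * u * v ^ 2 - 85 * u * v + 125)
    (hA1 : u * v - 15 < 0)
    (hA2 : 0 < u ^ 2 * v ^ 2 - 4 * u ^ 2 * v - 5 * u * v ^ 2 + 21 * u * v + 11 * v - 60) :
    {p : ℝ × ℝ | 0 < p.1 ∧ 0 < p.2 ∧
      p.1 = u * p.2 * (1 - p.2) ∧ p.2 = v * p.1 * (1 - p.1) ∧
      |u * v * (1 - 2 * p.1) * (1 - 2 * p.2)| < 1}.encard = 2 := by
  have hc2 := kopel_c2_nonneg u v hu hv hR1 hS3 hA1 hA2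
  have hw : 0 < u * v := mul_pos hu hv
  have hw1 : 1 < u * v := by
    by_contra h
    push Not at h
    have h1 : 0 < 4 * (u * v) * (u + v) := by positivity
    nlinarith
  -- existence of one root
  obtain ⟨a₀, ha₀⟩ : ∃ a : ℝ, u * v * (1 - a) * (1 - v * a + v * a ^ 2) - 1 = 0 := by
    have hcont : ContinuousOn
        (fun a : ℝ => u * v * (1 - a) * (1 - v * a + v * a ^ 2) - 1) (Set.Icc 0 1) := by
      fun_prop
    have := intermediate_value_Icc' (zero_le_one) hcont
    obtain ⟨a, -, ha⟩ := this (show (0 : ℝ) ∈ _ by constructor <;> norm_num <;> linarith)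
    exact ⟨a, ha⟩
  obtain ⟨a, b, c, hab, hbc, h1, h2, h3⟩ := kopel_three_roots (1 + 1 / v)
    ((1 - 1 / (u * v)) / v) (by
      have : 4 * (1 + 1 / v) ^ 2 - 4 * (1 + 1 / v) ^ 3 - 32 * ((1 - 1 / (u * v)) / v)
          + 36 * (1 + 1 / v) * ((1 - 1 / (u * v)) / v) - 27 * ((1 - 1 / (u * v)) / v) ^ 2
          = (u ^ 2 * v ^ 2 - 4 * u ^ 2 * v - 4 * u * v ^ 2 + 18 * u * v - 27)
            / (u ^ 2 * v ^ 4) := by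
        field_simp
        ring
      rw [this]
      positivity) a₀ (by
      field_simp
      linear_combination (-1) * ha₀)
  have hv2 : v * (a * b + b * c + c * a) = v + 1 := by rw [h2]; field_simp
  have hv3 : u * v * v * (a * b * c) = u * v - 1 := by rw [h3]; field_simp
  have hfac : ∀ x : ℝ, u * v * (1 - x) * (1 - v * x + v * x ^ 2) - 1
      = -(u * v * v) * ((x - a) * (x - b) * (x - c)) := by
    intro x
    linear_combination (-(u * v * v) * x ^ 2) * h1 + u * v * x * hv2 - hv3
  have hpos : ∀ x : ℝ, u * v * (1 - x) * (1 - v * x + v * x ^ 2) - 1 = 0 → 0 < x ∧ x < 1 := by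
    intro x hx
    constructor
    · by_contra h
      push Not at h
      have e1 : 1 ≤ 1 - v * x + v * x ^ 2 := by nlinarith [mul_nonneg hv.le (sq_nonneg x)]
      have e2 : u * v * 1 ≤ u * v * (1 - x) := by
        apply mul_le_mul_of_nonneg_left _ hw.le; linarith
      nlinarith
    · by_contra h
      push Not at h
      have e1 : 0 ≤ 1 - v * x + v * x ^ 2 := by
        nlinarith [mul_nonneg hv.le (mul_nonneg (by linarith : 0 ≤ x) (by linarith : 0 ≤ x - 1))]
      have e2 : 0 ≤ u * v * (x - 1) := mul_nonneg hw.le (by linarith)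
      nlinarith [mul_nonneg e2 e1]
  have ga : u * v * (1 - a) * (1 - v * a + v * a ^ 2) - 1 = 0 := by rw [hfac]; ring
  have gb : u * v * (1 - b) * (1 - v * b + v * b ^ 2) - 1 = 0 := by rw [hfac]; ring
  have gc : u * v * (1 - c) * (1 - v * c + v * c ^ 2) - 1 = 0 := by rw [hfac]; ring
  obtain ⟨ha0, ha1⟩ := hpos a ga
  obtain ⟨hb0, hb1⟩ := hpos b gb
  obtain ⟨hc0, hc1⟩ := hpos c gc
  -- the multipliers
  obtain ⟨D, hD⟩ : ∃ D : ℝ → ℝ, ∀ x, D x = u * v * (1 - 2 * x) * (1 - 2 * (v * x * (1 - x))) :=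
    ⟨fun x => u * v * (1 - 2 * x) * (1 - 2 * (v * x * (1 - x))), fun _ => rfl⟩
  have hDa : D a = 1 - u * v * v * a * ((b - a) * (c - a)) := by
    rw [hD]
    linear_combination ga + (u * v * v * a * (-2 * a)) * h1 + u * v * a * hv2
  have hDb : D b = 1 + u * v * v * b * ((b - a) * (c - b)) := by
    rw [hD]
    linear_combination gb + (u * v * v * b * (-2 * b)) * h1 + u * v * b * hv2
  have hDc : D c = 1 - u * v * v * c * ((c - a) * (c - b)) := by
    rw [hD]
    linear_combination gc + (u * v * v * c * (-2 * c)) * h1 + u * v * c * hv2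
  have hba : 0 < b - a := by linarith
  have hcb : 0 < c - b := by linarith
  have hca : 0 < c - a := by linarith
  have hDa1 : D a < 1 := by
    have : 0 < u * v * v * a * ((b - a) * (c - a)) := by positivity
    linarith
  have hDc1 : D c < 1 := by
    have : 0 < u * v * v * c * ((c - a) * (c - b)) := by positivity
    linarith
  have hDb1 : 1 < D b := by
    have : 0 < u * v * v * b * ((b - a) * (c - b)) := by positivity
    linarith
  -- linear form of the multipliers
  have hlin : ∀ x : ℝ, u * v * (1 - x) * (1 - v * x + v * x ^ 2) - 1 = 0 →
      D x + 1 = 5 - 3 * (u * v) + 2 * (u * v) * (x * (1 + v - v * x)) := by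
    intro x hx
    rw [hD]
    linear_combination 4 * hx
  obtain ⟨p, hp⟩ : ∃ p, p = a * (1 + v - v * a) := ⟨_, rfl⟩
  obtain ⟨q, hq⟩ : ∃ q, q = b * (1 + v - v * b) := ⟨_, rfl⟩
  obtain ⟨s, hs⟩ : ∃ s, s = c * (1 + v - v * c) := ⟨_, rfl⟩
  have hza := hlin a ga
  have hzb := hlin b gb
  have hzc := hlin c gc
  rw [← hp] at hza
  rw [← hq] at hzb
  rw [← hs] at hzc
  have E1 : p + q + s = 4 := by
    have : p + q + s = (1 + v) * (a + b + c)
        - v * ((a + b + c) ^ 2 - 2 * (a * b + b * c + c * a)) := by subst hp hq hs; ring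
    rw [this, h1, h2]; field_simp; ring
  have E2 : p * q + q * s + s * p = 5 + 1 / u + 1 / v - 3 / (u * v) := by
    have : p * q + q * s + s * p = (1 + v) ^ 2 * (a * b + b * c + c * a)
        - v * (1 + v) * ((a + b + c) * (a * b + b * c + c * a) - 3 * (a * b * c))
        + v ^ 2 * ((a * b + b * c + c * a) ^ 2 - 2 * (a + b + c) * (a * b * c)) := by
      subst hp hq hs; ring
    rw [this, h1, h2, h3]; field_simp; ring
  have E3 : p * q * s = ((1 - 1 / (u * v)) / v) * ((1 + v) ^ 3 - (1 + v) ^ 2 * v * 2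
      + (1 + v) * v ^ 2 * (1 + 1 / v) - v ^ 3 * ((1 - 1 / (u * v)) / v)) := by
    rw [← h1, ← h2, ← h3]; subst hp hq hs; ring
  have Z1 : (D a + 1) + (D b + 1) + (D c + 1) = 15 - u * v := by
    rw [hza, hzb, hzc]; linear_combination 2 * (u * v) * E1
  have Z2 : (D a + 1) * (D b + 1) + (D b + 1) * (D c + 1) + (D c + 1) * (D a + 1)
      = 75 - 22 * (u * v) - (u * v) ^ 2 + 4 * (u * v) * (u + v) := by
    have : (D a + 1) * (D b + 1) + (D b + 1) * (D c + 1) + (D c + 1) * (D a + 1)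
      = 3 * (5 - 3 * (u * v)) ^ 2 + 2 * (5 - 3 * (u * v)) * (2 * (u * v)) * (p + q + s)
        + (2 * (u * v)) ^ 2 * (p * q + q * s + s * p) := by rw [hza, hzb, hzc]; ring
    rw [this, E1, E2]; field_simp; ring
  have Z3 : (D a + 1) * (D b + 1) * (D c + 1)
      = u ^ 3 * v ^ 3 - 4 * u ^ 3 * v ^ 2 - 4 * u ^ 2 * v ^ 3 + 15 * u ^ 2 * v ^ 2 +
      12 * u ^ 2 * v + 12 * u * v ^ 2 - 85 * u * v + 125 := by
    have : (D a + 1) * (D b + 1) * (D c + 1)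
      = (5 - 3 * (u * v)) ^ 3 + (5 - 3 * (u * v)) ^ 2 * (2 * (u * v)) * (p + q + s)
        + (5 - 3 * (u * v)) * (2 * (u * v)) ^ 2 * (p * q + q * s + s * p)
        + (2 * (u * v)) ^ 3 * (p * q * s) := by rw [hza, hzb, hzc]; ring
    rw [this, E1, E2, E3]; field_simp; ring
  rw [← Z3] at hS3
  rw [← Z2] at hc2
  have hac0 : 0 < (D a + 1) * (D c + 1) := by
    have : 0 < ((D a + 1) * (D c + 1)) * (D b + 1) := by linarith
    exact pos_of_mul_pos_left this (by linarith)
  have hboth : 0 < D a + 1 ∧ 0 < D c + 1 := by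
    rcases pos_and_pos_or_neg_and_neg_of_mul_pos hac0 with h | ⟨hna, hnc⟩
    · exact h
    · exfalso
      exact kopel_no_two_neg _ (D b + 1) _ hna hnc (by linarith) hc2
  have hset : {p : ℝ × ℝ | 0 < p.1 ∧ 0 < p.2 ∧
      p.1 = u * p.2 * (1 - p.2) ∧ p.2 = v * p.1 * (1 - p.1) ∧
      |u * v * (1 - 2 * p.1) * (1 - 2 * p.2)| < 1}
      = {(a, v * a * (1 - a)), (c, v * c * (1 - c))} := by
    have hmem : ∀ x, 0 < x → x < 1 → u * v * (1 - x) * (1 - v * x + v * x ^ 2) - 1 = 0 →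
        D x < 1 → 0 < D x + 1 → (x, v * x * (1 - x)) ∈ {p : ℝ × ℝ | 0 < p.1 ∧ 0 < p.2 ∧
      p.1 = u * p.2 * (1 - p.2) ∧ p.2 = v * p.1 * (1 - p.1) ∧
      |u * v * (1 - 2 * p.1) * (1 - 2 * p.2)| < 1} := by
      intro x hx0 hx1 gx hx2 hx3
      have hx4 : 0 < 1 - x := by linarith
      refine ⟨hx0, by positivity, ?_, rfl, ?_⟩
      · show x = u * (v * x * (1 - x)) * (1 - v * x * (1 - x))
        linear_combination (-x) * gx
      · show |u * v * (1 - 2 * x) * (1 - 2 * (v * x * (1 - x)))| < 1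
        rw [← hD, abs_lt]
        constructor <;> linarith
    ext ⟨x, y⟩
    constructor
    · rintro ⟨hx0, hy0, hx, hy, hst⟩
      dsimp only at hx0 hy0 hx hy hst
      subst hy
      have gx : u * v * (1 - x) * (1 - v * x + v * x ^ 2) - 1 = 0 := by
        have : x * (u * v * (1 - x) * (1 - v * x + v * x ^ 2) - 1) = 0 := by
          linear_combination (-1) * hx
        exact (mul_eq_zero.mp this).resolve_left hx0.ne'
      rw [← hD, abs_lt] at hst
      rw [hfac] at gx
      have hk : -(u * v * v) ≠ 0 := by
        have : 0 < u * v * v := by positivity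
        exact (neg_lt_zero.mpr this).ne
      rcases mul_eq_zero.mp ((mul_eq_zero.mp gx).resolve_left hk) with h | h
      · rcases mul_eq_zero.mp h with h | h
        · have : x = a := by linarith
          subst this; simp
        · have : x = b := by linarith
          subst this; linarith [hst.2]
      · have : x = c := by linarith
        subst this; simp
    · rintro (h | h)
      · rw [h]; exact hmem a ha0 ha1 ga hDa1 hboth.1
      · rw [Set.mem_singleton_iff] at h
        rw [h]; exact hmem c hc0 hc1 gc hDc1 hboth.2
  rw [hset]
  apply Set.encard_pair
  intro h
  have := congrArg Prod.fst h
  dsimp only at this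
  linarith
end

section
/- Let u, v > 0 be real numbers and set R₁ = u²·v² − 4·u²·v − 4·u·v² + 18·u·v − 27 and S₃ = u³·v³ − 4·u³·v² − 4·u²·v³ + 15·u²·v² + 12·u²·v + 12·u·v² − 85·u·v + 125. If either (u·v > 1, R₁ < 0 and S₃ > 0) or (u·v > 1, R₁ > 0 and S₃ < 0), then the set { (x, y) ∈ ℝ² : x > 0, y > 0, x = u·y·(1−y), y = v·x·(1−x), and |u·v·(1−2x)·(1−2y)| < 1 } of stable positive equilibria of Kopel's model with best response reactions (a = b = 1) has exactly one element. -/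
/-- Explicit form of the parameters in terms of the second and third symmetric functions. -/
lemma kopel_param (u v E e : ℝ) (hu : 0 < u) (hv : 0 < v) (hE : v * E = v + 1)
    (he : u * v ^ 2 * e = u * v - 1) :
    ∃ V P, 0 < V ∧ 0 < P ∧ v = 1 / V ∧ u = V ^ 2 / P ∧ V = E - 1 ∧ P = E - 1 - e := by
  have h1 : v * (E - 1) = 1 := by linarith
  have hV : 0 < E - 1 := by
    by_contra hn
    nlinarith
  have hu2 : u * (E - 1 - e) = (E - 1) ^ 2 := by
    have : v ^ 2 * (u * (E - 1 - e)) = v ^ 2 * (E - 1) ^ 2 := by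
      linear_combination u * v * h1 - he - (v * (E - 1) + 1) * h1
    exact mul_left_cancel₀ (by positivity) this
  have hP : 0 < E - 1 - e := by
    by_contra hn
    nlinarith [pow_pos hV 2]
  refine ⟨E - 1, E - 1 - e, hV, hP, ?_, ?_, rfl, rfl⟩
  · field_simp
    linarith
  · field_simp
    linarith

/-- Membership in the set of stable positive equilibria. -/
lemma kopel_mem (u v x y : ℝ) (hu : 0 < u) (hv : 0 < v) (h1 : 1 < u * v) :
    (0 < x ∧ 0 < y ∧ x = u * y * (1 - y) ∧ y = v * x * (1 - x) ∧
      |u * v * (1 - 2 * x) * (1 - 2 * y)| < 1) ↔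
    (u * v * (1 - x) * (1 - v * x * (1 - x)) = 1 ∧ y = v * x * (1 - x) ∧
      |u * v * (1 - 2 * x) * (1 - 2 * (v * x * (1 - x)))| < 1) := by
  constructor
  · rintro ⟨hx, hy, e1, e2, h⟩
    refine ⟨?_, e2, by rw [← e2]; exact h⟩
    have : x * (u * v * (1 - x) * (1 - v * x * (1 - x))) = x * 1 := by
      rw [← e2]
      linear_combination (-1) * e1 - (u * (1 - y)) * e2
    exact mul_left_cancel₀ hx.ne' this
  · rintro ⟨e1, e2, h⟩
    have hx1 : x < 1 := by
      by_contra hn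
      have hn' : 0 ≤ x - 1 := by linarith
      have : 0 ≤ u * v * (x - 1) * (1 + v * x * (x - 1)) := by
        have : 0 ≤ x := by linarith
        positivity
      nlinarith
    have hx0 : 0 < x := by
      by_contra hn
      have hn' : 0 ≤ -x := by linarith
      have h2 : 0 ≤ v * (-x) * (1 - x) := by
        have : 0 ≤ 1 - x := by linarith
        positivity
      have h3 : 1 ≤ (1 - x) * (1 - v * x * (1 - x)) := by nlinarith
      nlinarith
    have hy : 0 < y := by
      rw [e2]
      have : 0 < 1 - x := by linarith
      positivity
    refine ⟨hx0, hy, ?_, e2, by rw [e2]; exact h⟩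
    rw [e2]
    linear_combination (-x) * e1

lemma kopel_pos (u v x : ℝ) (hv : 0 < v) (h1 : 1 < u * v)
    (e1 : u * v * (1 - x) * (1 - v * x * (1 - x)) = 1) : 0 < x := by
  by_contra hn
  have hn' : 0 ≤ -x := by linarith
  have h2 : 0 ≤ v * (-x) * (1 - x) := by
    have : 0 ≤ 1 - x := by linarith
    positivity
  have h3 : 1 ≤ (1 - x) * (1 - v * x * (1 - x)) := by nlinarith
  nlinarith

/-- Factorization. -/
lemma kopel_factor (u v r s t x : ℝ) (h2 : r + s + t = 2)
    (hE : v * (r * s + s * t + t * r) = v + 1)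
    (he : u * v ^ 2 * (r * s * t) = u * v - 1) :
    u * v * (1 - x) * (1 - v * x * (1 - x)) - 1
      = -(u * v ^ 2) * ((x - r) * (x - s) * (x - t)) := by
  linear_combination (-u * v ^ 2 * x ^ 2) * h2 + (u * v * x) * hE - he

lemma kopel_mult (u v r s t : ℝ) (h2 : r + s + t = 2)
    (hE : v * (r * s + s * t + t * r) = v + 1)
    (he : u * v ^ 2 * (r * s * t) = u * v - 1) :
    u * v * (1 - 2 * r) * (1 - 2 * (v * r * (1 - r)))
      = 1 - u * v ^ 2 * (r * ((r - s) * (r - t))) := by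
  linear_combination (-3 * u * v ^ 2 * r ^ 2) * h2 + (2 * u * v * r) * hE - he

lemma kopel_S3 (u v r s t : ℝ) (hu : 0 < u) (hv : 0 < v) (h2 : r + s + t = 2)
    (hE : v * (r * s + s * t + t * r) = v + 1)
    (he : u * v ^ 2 * (r * s * t) = u * v - 1) :
    u ^ 3 * v ^ 3 - 4 * u ^ 3 * v ^ 2 - 4 * u ^ 2 * v ^ 3 + 15 * u ^ 2 * v ^ 2 +
              12 * u ^ 2 * v + 12 * u * v ^ 2 - 85 * u * v + 125
     = (2 - u * v ^ 2 * (r * ((r - s) * (r - t)))) * (2 - u * v ^ 2 * (s * ((s - r) * (s - t))))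
       * (2 - u * v ^ 2 * (t * ((t - r) * (t - s)))) := by
  obtain ⟨V, P, hV, hP, e1, e2, e3, e4⟩ := kopel_param u v _ _ hu hv hE he
  obtain rfl : t = 2 - r - s := by linarith
  rw [e2, e1]
  clear e1 e2 hE he
  field_simp
  rw [e4, e3]
  ring

lemma kopel_R1 (u v r α δ : ℝ) (hu : 0 < u) (hv : 0 < v) (h2 : r = 2 - 2 * α)
    (hE : v * (2 * r * α + (α ^ 2 + δ)) = v + 1)
    (he : u * v ^ 2 * (r * (α ^ 2 + δ)) = u * v - 1) :
    u ^ 2 * v ^ 2 - 4 * u ^ 2 * v - 4 * u * v ^ 2 + 18 * u * v - 27 =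
      (-4 * δ) * (u * v ^ 2 * ((r - α) ^ 2 + δ)) ^ 2 := by
  obtain ⟨V, P, hV, hP, e1, e2, e3, e4⟩ := kopel_param u v _ _ hu hv hE he
  subst h2
  rw [e2, e1]
  clear e1 e2 hE he
  field_simp
  rw [e4, e3]
  ring

lemma kopel_S3c (u v r α β : ℝ) (hu : 0 < u) (hv : 0 < v) (h2 : r = 2 - 2 * α)
    (hE : v * (2 * r * α + (α ^ 2 + β ^ 2)) = v + 1)
    (he : u * v ^ 2 * (r * (α ^ 2 + β ^ 2)) = u * v - 1) :
    u ^ 3 * v ^ 3 - 4 * u ^ 3 * v ^ 2 - 4 * u ^ 2 * v ^ 3 + 15 * u ^ 2 * v ^ 2 +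
              12 * u ^ 2 * v + 12 * u * v ^ 2 - 85 * u * v + 125
     = (2 - u * v ^ 2 * (r * ((r - α) ^ 2 + β ^ 2))) *
       ((2 + 2 * (u * v ^ 2) * β ^ 2 * (2 * α - r)) ^ 2 +
        (2 * (u * v ^ 2) * β * (α ^ 2 - β ^ 2 - r * α)) ^ 2) := by
  obtain ⟨V, P, hV, hP, e1, e2, e3, e4⟩ := kopel_param u v _ _ hu hv hE he
  subst h2
  rw [e2, e1]
  clear e1 e2 hE he
  field_simp
  rw [e4, e3]
  ring

/-- Three distinct real roots. -/
lemma kopel_three (u v a b c : ℝ) (hu : 0 < u) (hv : 0 < v) (h1 : 1 < u * v)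
    (hab : a < b) (hbc : b < c) (h2 : a + b + c = 2)
    (hE : v * (a * b + b * c + c * a) = v + 1)
    (he : u * v ^ 2 * (a * b * c) = u * v - 1)
    (hS : u ^ 3 * v ^ 3 - 4 * u ^ 3 * v ^ 2 - 4 * u ^ 2 * v ^ 3 + 15 * u ^ 2 * v ^ 2 +
              12 * u ^ 2 * v + 12 * u * v ^ 2 - 85 * u * v + 125 < 0) :
    {p : ℝ × ℝ | 0 < p.1 ∧ 0 < p.2 ∧
      p.1 = u * p.2 * (1 - p.2) ∧ p.2 = v * p.1 * (1 - p.1) ∧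
      |u * v * (1 - 2 * p.1) * (1 - 2 * p.2)| < 1}.encard = 1 := by
  have hw : 0 < u * v ^ 2 := by positivity
  have hf := fun x => kopel_factor u v a b c x h2 hE he
  have ra : u * v * (1 - a) * (1 - v * a * (1 - a)) = 1 := by have := hf a; simp at this; linarith
  have rb : u * v * (1 - b) * (1 - v * b * (1 - b)) = 1 := by have := hf b; simp at this; linarith
  have rc : u * v * (1 - c) * (1 - v * c * (1 - c)) = 1 := by have := hf c; simp at this; linarith
  have pa := kopel_pos u v a hv h1 ra
  have pb := kopel_pos u v b hv h1 rb
  have pc := kopel_pos u v c hv h1 rc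
  have ma := kopel_mult u v a b c h2 hE he
  have mb := kopel_mult u v b a c (by linarith) (by linarith) (by linarith)
  have mc := kopel_mult u v c a b (by linarith) (by linarith) (by linarith)
  have s3 := kopel_S3 u v a b c hu hv h2 hE he
  rw [s3] at hS
  have ab : 0 < b - a := by linarith
  have bc : 0 < c - b := by linarith
  have ac : 0 < c - a := by linarith
  have ta : 0 < u * v ^ 2 * (a * ((a - b) * (a - c))) := by
    have : 0 < u * v ^ 2 * (a * ((b - a) * (c - a))) := by positivity
    linarith
  have tb : u * v ^ 2 * (b * ((b - a) * (b - c))) < 0 := by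
    have : 0 < u * v ^ 2 * (b * ((b - a) * (c - b))) := by positivity
    linarith
  have tc : 0 < u * v ^ 2 * (c * ((c - a) * (c - b))) := by positivity
  generalize u * v ^ 2 * (a * ((a - b) * (a - c))) = A at *
  generalize u * v ^ 2 * (b * ((b - a) * (b - c))) = B at *
  generalize u * v ^ 2 * (c * ((c - a) * (c - b))) = C at *
  have roots : ∀ x, u * v * (1 - x) * (1 - v * x * (1 - x)) = 1 → x = a ∨ x = b ∨ x = c := by
    intro x hx
    have h0 := hf x
    rw [hx] at h0
    have h3 : (x - a) * (x - b) * (x - c) = 0 := by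
      have : (u * v ^ 2) * ((x - a) * (x - b) * (x - c)) = 0 := by linarith
      exact (mul_eq_zero.mp this).resolve_left hw.ne'
    rcases mul_eq_zero.mp h3 with h3 | h3
    · rcases mul_eq_zero.mp h3 with h3 | h3
      · left; linarith
      · right; left; linarith
    · right; right; linarith
  have hAC : (2 - A) * (2 - C) < 0 := by
    by_contra hn
    have : 0 ≤ (2 - A) * (2 - C) := by linarith
    have : 0 ≤ (2 - A) * (2 - C) * (2 - B) := mul_nonneg this (by linarith)
    linarith
  rw [Set.encard_eq_one]
  rcases lt_or_ge A 2 with hA | hA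
  · have hC : 2 < C := by
      by_contra hn
      have : 0 ≤ (2 - A) * (2 - C) := mul_nonneg (by linarith) (by linarith)
      linarith
    refine ⟨(a, v * a * (1 - a)), ?_⟩
    ext ⟨x, y⟩
    simp only [Set.mem_setOf_eq, Set.mem_singleton_iff, Prod.mk.injEq]
    rw [kopel_mem u v x y hu hv h1]
    constructor
    · rintro ⟨e1, e2, e3⟩
      rcases roots x e1 with rfl | rfl | rfl
      · exact ⟨rfl, e2⟩
      · rw [mb, abs_lt] at e3; linarith
      · rw [mc, abs_lt] at e3; linarith
    · rintro ⟨rfl, e2⟩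
      refine ⟨ra, e2, ?_⟩
      rw [ma, abs_lt]; constructor <;> linarith
  · have hC : C < 2 := by
      by_contra hn
      have : 0 ≤ (A - 2) * (C - 2) := mul_nonneg (by linarith) (by linarith)
      linarith
    have hA' : 2 < A := lt_of_le_of_ne hA (by rintro rfl; norm_num at hAC)
    refine ⟨(c, v * c * (1 - c)), ?_⟩
    ext ⟨x, y⟩
    simp only [Set.mem_setOf_eq, Set.mem_singleton_iff, Prod.mk.injEq]
    rw [kopel_mem u v x y hu hv h1]
    constructor
    · rintro ⟨e1, e2, e3⟩
      rcases roots x e1 with rfl | rfl | rfl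
      · rw [ma, abs_lt] at e3; linarith
      · rw [mb, abs_lt] at e3; linarith
      · exact ⟨rfl, e2⟩
    · rintro ⟨rfl, e2⟩
      refine ⟨rc, e2, ?_⟩
      rw [mc, abs_lt]; constructor <;> linarith


/-- One stable positive equilibrium for Kopel's model with best response reactions. -/
theorem kopel_one_stable_positive_equilibrium
    (u v : ℝ) (hu : 0 < u) (hv : 0 < v)
    (h : (1 < u * v ∧
            u ^ 2 * v ^ 2 - 4 * u ^ 2 * v - 4 * u * v ^ 2 + 18 * u * v - 27 < 0 ∧
            0 < u ^ 3 * v ^ 3 - 4 * u ^ 3 * v ^ 2 - 4 * u ^ 2 * v ^ 3 + 15 * u ^ 2 * v ^ 2 +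
              12 * u ^ 2 * v + 12 * u * v ^ 2 - 85 * u * v + 125) ∨
         (1 < u * v ∧
            0 < u ^ 2 * v ^ 2 - 4 * u ^ 2 * v - 4 * u * v ^ 2 + 18 * u * v - 27 ∧
            u ^ 3 * v ^ 3 - 4 * u ^ 3 * v ^ 2 - 4 * u ^ 2 * v ^ 3 + 15 * u ^ 2 * v ^ 2 +
              12 * u ^ 2 * v + 12 * u * v ^ 2 - 85 * u * v + 125 < 0)) :
    {p : ℝ × ℝ | 0 < p.1 ∧ 0 < p.2 ∧
      p.1 = u * p.2 * (1 - p.2) ∧ p.2 = v * p.1 * (1 - p.1) ∧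
      |u * v * (1 - 2 * p.1) * (1 - 2 * p.2)| < 1}.encard = 1 := by
  have h1 : 1 < u * v := by rcases h with h | h <;> exact h.1
  have hw : 0 < u * v ^ 2 := by positivity
  obtain ⟨r, hr⟩ : ∃ r, u * v * (1 - r) * (1 - v * r * (1 - r)) = 1 := by
    have hc : ContinuousOn (fun r : ℝ => u * v * (1 - r) * (1 - v * r * (1 - r))) (Set.Icc 0 1) := by
      fun_prop
    have := intermediate_value_Icc' (zero_le_one' ℝ) hc
    obtain ⟨r, _, hr⟩ := this (show (1 : ℝ) ∈ _ by constructor <;> norm_num; linarith)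
    exact ⟨r, hr⟩
  have hr0 := kopel_pos u v r hv h1 hr
  obtain ⟨α, hα⟩ : ∃ α, r = 2 - 2 * α := ⟨1 - r / 2, by ring⟩
  obtain ⟨δ, hδ⟩ : ∃ δ, v * (2 * r * α + (α ^ 2 + δ)) = v + 1 :=
    ⟨1 + 1 / v - 2 * r * α - α ^ 2, by field_simp; ring⟩
  have he : u * v ^ 2 * (r * (α ^ 2 + δ)) = u * v - 1 := by
    have : α = 1 - r / 2 := by linarith
    subst this
    linear_combination (u * v * r) * hδ - hr
  have hR := kopel_R1 u v r α δ hu hv hα hδ he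
  rcases h with ⟨_, h2, h3⟩ | ⟨_, h2, h3⟩
  · have hδ0 : 0 < δ := by
      by_contra hn
      rw [hR] at h2
      have : 0 ≤ (-4 * δ) * (u * v ^ 2 * ((r - α) ^ 2 + δ)) ^ 2 :=
        mul_nonneg (by linarith) (sq_nonneg _)
      linarith
    obtain ⟨β, rfl⟩ : ∃ β, δ = β ^ 2 := ⟨√δ, (Real.sq_sqrt hδ0.le).symm⟩
    rw [kopel_S3c u v r α β hu hv hα hδ he] at h3
    have hpos : 0 < 2 - u * v ^ 2 * (r * ((r - α) ^ 2 + β ^ 2)) :=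
      pos_of_mul_pos_left h3 (by positivity)
    have ht : 0 < u * v ^ 2 * (r * ((r - α) ^ 2 + β ^ 2)) := by positivity
    have hm : u * v * (1 - 2 * r) * (1 - 2 * (v * r * (1 - r)))
        = 1 - u * v ^ 2 * (r * ((r - α) ^ 2 + β ^ 2)) := by
      have : α = 1 - r / 2 := by linarith
      subst this
      linear_combination (2 * u * v * r) * hδ - he
    rw [Set.encard_eq_one]
    refine ⟨(r, v * r * (1 - r)), ?_⟩
    ext ⟨x, y⟩
    simp only [Set.mem_setOf_eq, Set.mem_singleton_iff, Prod.mk.injEq]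
    rw [kopel_mem u v x y hu hv h1]
    constructor
    · rintro ⟨e1, e2, e3⟩
      have hx : (u * v ^ 2 * ((x - α) ^ 2 + β ^ 2)) * (x - r) = 0 := by
        have : α = 1 - r / 2 := by linarith
        subst this
        linear_combination (u * v * x) * hδ - he - e1
      have hxr : x = r := by
        rcases mul_eq_zero.mp hx with h | h
        · exact absurd h (by positivity)
        · linarith
      subst hxr
      exact ⟨rfl, e2⟩
    · rintro ⟨rfl, e2⟩
      refine ⟨hr, e2, ?_⟩
      rw [hm, abs_lt]; constructor <;> linarith
  · rw [hR] at h2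
    have hδ0 : δ < 0 := by
      by_contra hn
      have : 0 ≤ (4 * δ) * (u * v ^ 2 * ((r - α) ^ 2 + δ)) ^ 2 :=
        mul_nonneg (by linarith) (sq_nonneg _)
      linarith
    obtain ⟨β, hβ, rfl⟩ : ∃ β, 0 < β ∧ δ = -β ^ 2 :=
      ⟨√(-δ), Real.sqrt_pos.mpr (by linarith), by rw [Real.sq_sqrt (by linarith)]; ring⟩
    have hne1 : r ≠ α - β := by
      intro hh
      have : (r - α) ^ 2 + -β ^ 2 = 0 := by rw [hh]; ring
      rw [this] at h2; simp at h2
    have hne2 : r ≠ α + β := by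
      intro hh
      have : (r - α) ^ 2 + -β ^ 2 = 0 := by rw [hh]; ring
      rw [this] at h2; simp at h2
    rcases lt_or_gt_of_ne hne1 with h4 | h4
    · exact kopel_three u v r (α - β) (α + β) hu hv h1 h4 (by linarith) (by linarith)
        (by linarith) (by linarith) h3
    rcases lt_or_gt_of_ne hne2 with h5 | h5
    · exact kopel_three u v (α - β) r (α + β) hu hv h1 h4 h5 (by linarith)
        (by linarith) (by linarith) h3
    · exact kopel_three u v (α - β) (α + β) r hu hv h1 (by linarith) h5 (by linarith)
        (by linarith) (by linarith) h3
end
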